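/- Let f, T ∈ F_q[x] be monic divisors of x^n − 1 with deg f = k and gcd((x^n − 1)/f, T) ≠ 1, and let m be a positive divisor of q^n − 1. Let Q_1, …, Q_s be monic irreducible polynomials in F_q[x] and p_1, …, p_r be prime numbers such that rad(x^n − 1) = rad(T) · Q_1 ⋯ Q_s and rad(q^n − 1) = rad(m) · p_1 ⋯ p_r. Then N_f(x^n − 1, q^n − 1) ≥ Σ_{i=1}^r N_f(T, m·p_i) + Σ_{j=1}^s N_f(T·Q_j, m) − (r + s − 1) · N_f(T, m). -/

import Mathlib

open Polynomial

noncomputable section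

/-- The linearized `q`-associate of `f = Σ a_i x^i ∈ F_q[x]`, evaluated at `α ∈ F_{q^n}`:
`L_f(α) = Σ a_i α^{q^i}`. -/
def Lf {F E : Type*} [Field F] [Field E] [Algebra F E] (q : ℕ) (f : Polynomial F) (α : E) : E :=
  ∑ i ∈ Finset.range (f.natDegree + 1), algebraMap F E (f.coeff i) * α ^ q ^ i

/-- For `m ∣ q^n - 1`, an element `α ∈ F_{q^n}*` is `m`-free if whenever `α = β^d` for some
`β ∈ F_{q^n}` and some divisor `d` of `m`, then `d = 1`. -/
def IsFree {E : Type*} [Field E] (m : ℕ) (α : E) : Prop :=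
  α ≠ 0 ∧ ∀ d : ℕ, d ∣ m → (∃ β : E, α = β ^ d) → d = 1

/-- For a monic divisor `T` of `x^n - 1` in `F_q[x]`, an element `α ∈ F_{q^n}` is `T`-free
if whenever `α = L_h(β)` for some `β ∈ F_{q^n}` and some monic divisor `h` of `T`,
then `h = 1`. -/
def IsPolyFree {F E : Type*} [Field F] [Field E] [Algebra F E] (q : ℕ) (T : Polynomial F)
    (α : E) : Prop :=
  ∀ h : Polynomial F, h.Monic → h ∣ T → (∃ β : E, Lf q h β = α) → h = 1

/-- `Nf q F E f T m` is the number of `T`-free elements `α ∈ F_{q^n}` such that `L_f(α)` is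
`m`-free. -/
def Nf (q : ℕ) (F E : Type*) [Field F] [Field E] [Algebra F E]
    (f T : Polynomial F) (m : ℕ) : ℕ :=
  Nat.card {α : E // IsPolyFree q T α ∧ IsFree m (Lf q f α)}

/-- `Wnat m` is the number of squarefree divisors of the integer `m`. -/
def Wnat (m : ℕ) : ℕ := Nat.card {d : ℕ // d ∣ m ∧ Squarefree d}

/-- `Wpoly T` is the number of squarefree monic divisors of the polynomial `T`. -/
def Wpoly {F : Type*} [Field F] (T : Polynomial F) : ℕ :=
  Nat.card {h : Polynomial F // h.Monic ∧ Squarefree h ∧ h ∣ T}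

/-- `radNat m` is the largest squarefree divisor of the positive integer `m`. -/
def radNat (m : ℕ) : ℕ := ∏ p ∈ m.primeFactors, p

/-- `radPoly T` is the monic squarefree radical of the polynomial `T` : the product of its
distinct monic irreducible factors. -/
def radPoly {F : Type*} [Field F] (T : Polynomial F) : Polynomial F :=
  letI := Classical.decEq F
  ∏ p ∈ (UniqueFactorizationMonoid.normalizedFactors T).toFinset, p

/-- Bonferroni-type bound: if every `A i` is contained in `S`, and the elements of `S` lying in all
`A i` belong to `U`, then `Σ |A i| - (|ι| - 1) |S| ≤ |U|`. -/
theorem sum_card_sub_le_card_of_forall_mem {E ι : Type*} [Finite E] [Fintype ι]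
    (S U : Set E) (A : ι → Set E) (hA : ∀ i, A i ⊆ S)
    (hU : ∀ x ∈ S, (∀ i, x ∈ A i) → x ∈ U) :
    (∑ i, (Nat.card (A i) : ℤ)) - ((Fintype.card ι : ℤ) - 1) * (Nat.card S : ℤ)
      ≤ (Nat.card U : ℤ) := by
  simp only [Nat.card_coe_set_eq]
  have hcover : S ⊆ U ∪ ⋃ i, S \ A i := by
    intro x hx
    by_cases h : ∀ i, x ∈ A i
    · exact Or.inl (hU x hx h)
    · push Not at h
      obtain ⟨i, hi⟩ := h
      exact Or.inr (Set.mem_iUnion.2 ⟨i, hx, hi⟩)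
  have h1 : S.ncard ≤ U.ncard + ∑ i, (S \ A i).ncard :=
    (Set.ncard_le_ncard hcover).trans <| (Set.ncard_union_le _ _).trans <|
      Nat.add_le_add_left (Set.ncard_iUnion_le_of_fintype _) _
  have h2 : ∀ i, ((S \ A i).ncard : ℤ) = (S.ncard : ℤ) - ((A i).ncard : ℤ) := fun i => by
    have := Set.ncard_sdiff_add_ncard_of_subset (hA i)
    omega
  have h3 : (S.ncard : ℤ) ≤ U.ncard + ∑ i, ((S \ A i).ncard : ℤ) := by exact_mod_cast h1
  simp only [h2, Finset.sum_sub_distrib, Finset.sum_const, Finset.card_univ, nsmul_eq_mul] at h3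
  linarith

theorem IsFree.of_dvd {E : Type*} [Field E] {a b : ℕ} {α : E} (hab : a ∣ b) (h : IsFree b α) :
    IsFree a α :=
  ⟨h.1, fun d hd => h.2 d (hd.trans hab)⟩

/-- Freeness only needs to be tested on prime divisors. -/
theorem isFree_of_forall_prime {E : Type*} [Field E] {N : ℕ} {α : E} (hα : α ≠ 0)
    (h : ∀ l : ℕ, l.Prime → l ∣ N → ¬ ∃ β : E, α = β ^ l) : IsFree N α := by
  refine ⟨hα, fun d hd ⟨β, hβ⟩ => ?_⟩
  by_contra hd1
  obtain ⟨l, hl, c, rfl⟩ := Nat.exists_prime_and_dvd hd1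
  exact h l hl ((dvd_mul_right l c).trans hd) ⟨β ^ c, by rw [hβ, mul_comm, pow_mul]⟩

theorem Nat.Prime.dvd_radNat_iff {l N : ℕ} (hl : l.Prime) (hN : N ≠ 0) :
    l ∣ radNat N ↔ l ∣ N := by
  constructor
  · exact fun h => h.trans (Nat.prod_primeFactors_dvd N)
  · exact fun h => Finset.dvd_prod_of_mem (fun p => p) (Nat.mem_primeFactors.2 ⟨hl, h, hN⟩)

section PolyFree

variable {F E : Type*} [Field F] [Field E] [Algebra F E]

theorem IsPolyFree.of_dvd {q : ℕ} {S T : F[X]} {α : E} (hST : S ∣ T)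
    (h : IsPolyFree q T α) : IsPolyFree q S α :=
  fun g hg hgS => h g hg (hgS.trans hST)

theorem Lf_eq_aeval_frobenius [Fintype F] (f : F[X]) (α : E) :
    Lf (Fintype.card F) f α
      = aeval (FiniteField.frobeniusAlgHom F E).toLinearMap f α := by
  have hpow : ∀ i : ℕ, ((FiniteField.frobeniusAlgHom F E).toLinearMap ^ i) α
      = α ^ Fintype.card F ^ i := by
    intro i
    induction i with
    | zero => simp
    | succ i ih =>
      rw [pow_succ', Module.End.mul_apply, ih, AlgHom.toLinearMap_apply,
        FiniteField.frobeniusAlgHom_apply, ← pow_mul, pow_succ]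
  simp [Lf, aeval_eq_sum_range, hpow, Algebra.smul_def]

theorem Lf_mul [Fintype F] (f g : F[X]) (α : E) :
    Lf (Fintype.card F) (f * g) α = Lf (Fintype.card F) f (Lf (Fintype.card F) g α) := by
  simp [Lf_eq_aeval_frobenius]

/-- Freeness only needs to be tested on monic irreducible divisors. -/
theorem isPolyFree_of_forall_irreducible [Fintype F] {N : F[X]} {α : E}
    (h : ∀ P : F[X], P.Monic → Irreducible P → P ∣ N →
      ¬ ∃ β : E, Lf (Fintype.card F) P β = α) :
    IsPolyFree (Fintype.card F) N α := by
  intro g hg hgN ⟨β, hβ⟩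
  by_contra hg1
  obtain ⟨P, hPm, hPi, c, rfl⟩ :=
    exists_monic_irreducible_factor g (fun hu => hg1 (hg.eq_one_of_isUnit hu))
  exact h P hPm hPi ((dvd_mul_right P c).trans hgN) ⟨_, by rw [← Lf_mul, hβ]⟩

theorem Irreducible.dvd_radPoly_iff {P N : F[X]} (hP : Irreducible P) (hN : N ≠ 0) :
    P ∣ radPoly N ↔ P ∣ N := by
  classical
  unfold radPoly
  constructor
  · intro h
    obtain ⟨R, hR, hPR⟩ := (hP.prime.dvd_finsetProd_iff _).1 h
    exact hPR.trans (UniqueFactorizationMonoid.dvd_of_mem_normalizedFactors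
      (Multiset.mem_toFinset.1 hR))
  · intro h
    obtain ⟨R, hR, hPR⟩ :=
      UniqueFactorizationMonoid.exists_mem_normalizedFactors_of_dvd hN hP h
    exact hPR.dvd.trans (Finset.dvd_prod_of_mem (fun p => p) (Multiset.mem_toFinset.2 hR))

end PolyFree

/-- The sieving inequality:
`N_f(x^n-1, q^n-1) ≥ Σ_i N_f(T, m·p_i) + Σ_j N_f(T·Q_j, m) - (r + s - 1)·N_f(T, m)`,
where `rad(x^n - 1) = rad(T)·Q_1⋯Q_s` and `rad(q^n - 1) = rad(m)·p_1⋯p_r`. -/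
theorem Nf_sieve (q n k : ℕ) (hn : 0 < n)
    (F E : Type*) [Field F] [Fintype F] [Field E] [Fintype E] [Algebra F E]
    (hF : Fintype.card F = q) (hE : Fintype.card E = q ^ n)
    (f T : Polynomial F) (hfm : f.Monic) (hTm : T.Monic)
    (hfd : f ∣ (X : Polynomial F) ^ n - 1) (hTd : T ∣ (X : Polynomial F) ^ n - 1)
    (hk : f.natDegree = k)
    (hncop : ¬ IsCoprime (((X : Polynomial F) ^ n - 1) / f) T)
    (m : ℕ) (hm : 0 < m) (hmd : m ∣ q ^ n - 1)
    (r s : ℕ) (p : Fin r → ℕ) (hp : ∀ i, (p i).Prime)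
    (Q : Fin s → Polynomial F) (hQ : ∀ j, (Q j).Monic ∧ Irreducible (Q j))
    (hradP : radPoly ((X : Polynomial F) ^ n - 1) = radPoly T * ∏ j, Q j)
    (hradN : radNat (q ^ n - 1) = radNat m * ∏ i, p i) :
    (∑ i, (Nf q F E f T (m * p i) : ℤ)) + (∑ j, (Nf q F E f (T * Q j) m : ℤ))
        - ((r : ℤ) + (s : ℤ) - 1) * (Nf q F E f T m : ℤ)
      ≤ (Nf q F E f ((X : Polynomial F) ^ n - 1) (q ^ n - 1) : ℤ) := by
  subst hF
  have hN : Fintype.card F ^ n - 1 ≠ 0 := by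
    have := Fintype.one_lt_card (α := E)
    omega
  have hX : (X : F[X]) ^ n - 1 ≠ 0 := (monic_X_pow_sub_C 1 hn.ne').ne_zero
  set c := Fintype.card F
  have key := sum_card_sub_le_card_of_forall_mem
    {α : E | IsPolyFree c T α ∧ IsFree m (Lf c f α)}
    {α : E | IsPolyFree c ((X : F[X]) ^ n - 1) α ∧ IsFree (c ^ n - 1) (Lf c f α)}
    (Sum.elim (fun i : Fin r => {α : E | IsPolyFree c T α ∧ IsFree (m * p i) (Lf c f α)})
      (fun j : Fin s => {α : E | IsPolyFree c (T * Q j) α ∧ IsFree m (Lf c f α)})) ?_ ?_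
  · simp only [Fintype.sum_sum_type, Sum.elim_inl, Sum.elim_inr, Fintype.card_sum,
      Fintype.card_fin, Nat.cast_add] at key
    exact key
  · rintro (i | j) α ⟨h1, h2⟩
    · exact ⟨h1, h2.of_dvd (dvd_mul_right _ _)⟩
    · exact ⟨h1.of_dvd (dvd_mul_right _ _), h2⟩
  · rintro α ⟨hT, hfree⟩ hall
    constructor
    · refine isPolyFree_of_forall_irreducible fun P hPm hPi hPd hβ => hPi.ne_one ?_
      rw [← hPi.dvd_radPoly_iff hX, hradP, hPi.prime.dvd_mul, hPi.dvd_radPoly_iff hTm.ne_zero,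
        hPi.prime.dvd_finsetProd_iff] at hPd
      obtain hPT | ⟨j, -, hPj⟩ := hPd
      · exact hT P hPm hPT hβ
      · exact (hall (Sum.inr j)).1 P hPm (hPj.mul_left T) hβ
    · refine isFree_of_forall_prime hfree.1 fun l hl hld hβ => hl.ne_one ?_
      rw [← hl.dvd_radNat_iff hN, hradN, hl.dvd_mul, hl.dvd_radNat_iff hm.ne',
        hl.prime.dvd_finsetProd_iff] at hld
      obtain hlm | ⟨i, -, hli⟩ := hld
      · exact hfree.2 l hlm hβ
      · exact (hall (Sum.inl i)).2.2 l (hli.mul_left m) hβ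

end
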